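/- For every special pair (T,λ), the polynomial P(T,λ) is irreducible in the polynomial ring ℤ[s_1,…,s_k], where {s_1,…,s_k} = λ(V(T)) is the set of variables occurring in it. -/

import Mathlib

/-- A rooted tree whose vertices carry labels from `K`. -/
inductive RTree (K : Type) : Type where
  | node : K → List (RTree K) → RTree K

namespace RTree

mutual
/-- The polynomial `P(T,λ)` of a vertex-labelled rooted tree. -/
noncomputable def P {K : Type} : RTree K → MvPolynomial K ℤ
  | .node k [] => MvPolynomial.X k
  | .node k (t :: ts) => MvPolynomial.X k + Pprod (t :: ts)
termination_by t => sizeOf t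
/-- Product of the polynomials of a list of labelled trees. -/
noncomputable def Pprod {K : Type} : List (RTree K) → MvPolynomial K ℤ
  | [] => 1
  | t :: ts => P t * Pprod ts
termination_by l => sizeOf l
end

/-- Isomorphism of vertex-labelled rooted trees: roots have the same label and
the children correspond bijectively by isomorphisms. -/
inductive Iso {K : Type} : RTree K → RTree K → Prop
  | node (k : K) (ts ts' : List (RTree K)) (e : Fin ts.length ≃ Fin ts'.length)
      (h : ∀ i : Fin ts.length, Iso (ts.get i) (ts'.get (e i))) :
      Iso (.node k ts) (.node k ts')

end RTree

/-- The variables: leaf variables `x i`, the variables `y`, `z`, and a set `S`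
of further variables (all pairwise distinct). -/
inductive Var (S : Type) : Type where
  | x : ℕ → Var S
  | y : Var S
  | z : Var S
  | s : S → Var S

mutual
/-- `SpecialAux b T` says the vertex-labelled tree `T` is special; the flag `b`
records whether the (virtual) parent of the root has outdegree 1. -/
def SpecialAux {S : Type} : Bool → RTree (Var S) → Prop
  | _, .node k [] => ∃ i, k = Var.x i
  | b, .node k [t] => (k = Var.y ∨ (b = false ∧ k = Var.z)) ∧ SpecialAux true t
  | _, .node k (t₁ :: t₂ :: ts) =>
      (k = Var.y ∨ k = Var.z ∨ ∃ a, k = Var.s a) ∧ SpecialList (t₁ :: t₂ :: ts)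
/-- All trees in the list are special (as non-string-continuation subtrees). -/
def SpecialList {S : Type} : List (RTree (Var S)) → Prop
  | [] => True
  | t :: ts => SpecialAux false t ∧ SpecialList ts
end

/-- A special pair: leaves are labelled by variables `x i`, a string
`(w₁,…,w_p)` is labelled so that `λ(w₁) ∈ {y,z}` and `λ(w_i) = y` for `i ≥ 2`,
and all remaining vertices have labels in `{y,z} ∪ S`. -/
def IsSpecial {S : Type} (T : RTree (Var S)) : Prop := SpecialAux false T


namespace SpecialIrr
open Polynomial

variable {S : Type}

/-- The ring of all polynomials. -/
abbrev R (S : Type) := MvPolynomial (Var S) ℤ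

/-- `x_i ↦ x_i T`, other variables fixed. -/
noncomputable def psi : R S →+* (R S)[X] :=
  MvPolynomial.eval₂Hom (C.comp MvPolynomial.C)
    (fun v => match v with
      | Var.x i => C (MvPolynomial.X (Var.x i)) * X
      | w => C (MvPolynomial.X w))

/-- `x_i ↦ 1`, other variables fixed. -/
noncomputable def eta : R S →+* R S :=
  MvPolynomial.eval₂Hom MvPolynomial.C
    (fun v => match v with
      | Var.x _ => 1
      | w => MvPolynomial.X w)

/-- all variables go to `y`. -/
noncomputable def rho : R S →+* ℤ[X] :=
  MvPolynomial.eval₂Hom C (fun _ => X)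

/-- `x_i ↦ 1`, other variables to `y`. -/
noncomputable def theta : R S →+* ℤ[X] := rho.comp eta

/-- `x_i ↦ x`, other variables to `y`. -/
noncomputable def phi : R S →+* ℤ[X][X] := (mapRingHom theta).comp psi

/-- internal labels -/
def Internal : Var S → Prop
  | Var.x _ => False
  | _ => True

lemma psi_x (i : ℕ) : psi (S := S) (MvPolynomial.X (Var.x i)) =
    C (MvPolynomial.X (Var.x i)) * X := by simp [psi]
lemma psi_int {k : Var S} (h : Internal k) : psi (MvPolynomial.X k) =
    C (MvPolynomial.X k) := by cases k <;> simp_all [psi, Internal]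
lemma eta_x (i : ℕ) : eta (S := S) (MvPolynomial.X (Var.x i)) = 1 := by simp [eta]
lemma eta_int {k : Var S} (h : Internal k) : eta (MvPolynomial.X k) =
    MvPolynomial.X k := by cases k <;> simp_all [eta, Internal]
lemma rho_X (k : Var S) : rho (MvPolynomial.X k) = X := by simp [rho]
lemma phi_x (i : ℕ) : phi (S := S) (MvPolynomial.X (Var.x i)) = X := by
  simp [phi, theta, psi_x, eta_x]
lemma phi_int {k : Var S} (h : Internal k) : phi (MvPolynomial.X k) = C X := by
  simp [phi, theta, psi_int h, eta_int h, rho_X]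

/-- The invariant. -/
structure Good (p : R S) : Prop where
  lc : eta (psi p).leadingCoeff = 1
  deg : 0 < (psi p).natDegree
  red : ∃ n : ℕ, (phi p).map (evalRingHom (0 : ℤ)) = X ^ n
  c0 : ((phi p).coeff 0).coeff 0 = 0
  c1 : 0 ≤ ((phi p).coeff 0).coeff 1

lemma good_x (i : ℕ) : Good (S := S) (MvPolynomial.X (Var.x i)) where
  lc := by rw [psi_x]; simp [eta_x]
  deg := by rw [psi_x, natDegree_C_mul_X _ (MvPolynomial.X_ne_zero _)]; simp
  red := ⟨1, by simp [phi_x]⟩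
  c0 := by simp [phi_x]
  c1 := by simp [phi_x]

lemma good_mul {p q : R S} (hp : Good p) (hq : Good q) : Good (p * q) where
  lc := by rw [map_mul, leadingCoeff_mul, map_mul, hp.lc, hq.lc, one_mul]
  deg := by
    have h1 : psi p ≠ 0 := ne_zero_of_natDegree_gt hp.deg
    have h2 : psi q ≠ 0 := ne_zero_of_natDegree_gt hq.deg
    rw [map_mul, natDegree_mul h1 h2]
    have := hp.deg
    omega
  red := by
    obtain ⟨n, hn⟩ := hp.red
    obtain ⟨m, hm⟩ := hq.red
    exact ⟨n + m, by rw [map_mul, Polynomial.map_mul, hn, hm, pow_add]⟩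
  c0 := by rw [map_mul, mul_coeff_zero, mul_coeff_zero, hp.c0, zero_mul]
  c1 := by rw [map_mul, mul_coeff_zero, mul_coeff_one, hp.c0, hq.c0]; simp

lemma good_add {p : R S} (hp : Good p) {k : Var S} (hk : Internal k) :
    Good (MvPolynomial.X k + p) where
  lc := by
    rw [map_add, psi_int hk, leadingCoeff_add_of_degree_lt, hp.lc]
    exact degree_C_le.trans_lt (natDegree_pos_iff_degree_pos.1 hp.deg)
  deg := by rw [map_add, psi_int hk, natDegree_C_add]; exact hp.deg
  red := by
    obtain ⟨n, hn⟩ := hp.red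
    exact ⟨n, by rw [map_add, phi_int hk, Polynomial.map_add, hn]; simp⟩
  c0 := by rw [map_add, phi_int hk]; simp [hp.c0]
  c1 := by rw [map_add, phi_int hk]; simp; linarith [hp.c1]

lemma theta_lc {p : R S} (hp : Good p) : theta (psi p).leadingCoeff = 1 := by
  simp [theta, hp.lc]

lemma natDegree_phi {p : R S} (hp : Good p) :
    (phi p).natDegree = (psi p).natDegree := by
  apply natDegree_map_of_leadingCoeff_ne_zero
  rw [theta_lc hp]; exact one_ne_zero

lemma phi_monic {p : R S} (hp : Good p) : (phi p).Monic := by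
  rw [Monic, leadingCoeff, natDegree_phi hp]
  simp only [phi, RingHom.comp_apply, coe_mapRingHom, coeff_map, coeff_natDegree, theta_lc hp]

lemma phi_irr {p : R S} (hp : Good p) (h1 : 0 < ((phi p).coeff 0).coeff 1) :
    Irreducible (phi p) := by
  have hm := phi_monic hp
  have hd : 0 < (phi p).natDegree := by rw [natDegree_phi hp]; exact hp.deg
  have hprime : (Ideal.span {(X : ℤ[X])}).IsPrime :=
    (Ideal.span_singleton_prime X_ne_zero).2 prime_X
  have hE : (phi p).IsEisensteinAt (Ideal.span {(X : ℤ[X])}) := by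
    refine ⟨?_, ?_, ?_⟩
    · rw [hm.leadingCoeff]
      exact fun h => hprime.ne_top ((Ideal.eq_top_iff_one _).2 h)
    · intro i hi
      obtain ⟨n, hn⟩ := hp.red
      have hnd : (phi p).natDegree = n := by
        rw [← hm.natDegree_map (evalRingHom (0 : ℤ)), hn, natDegree_X_pow]
      rw [Ideal.mem_span_singleton, X_dvd_iff, coeff_zero_eq_eval_zero]
      have := congrArg (fun f => coeff f i) hn
      simp only [coeff_map, coeff_X_pow, coe_evalRingHom] at this
      rw [this, if_neg (by omega)]
    · rw [Ideal.span_singleton_pow, Ideal.mem_span_singleton, X_pow_dvd_iff]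
      intro h
      have := h 1 (by norm_num)
      omega
  exact hE.irreducible hprime hm.isPrimitive hd

lemma eval_one_psi (p : R S) : (psi p).eval 1 = p := by
  have : (evalRingHom (1 : R S)).comp psi = RingHom.id _ := by
    apply MvPolynomial.ringHom_ext
    · intro r; simp [psi]
    · intro v; cases v <;> simp [psi]
  exact congrArg (fun f : R S →+* R S => f p) this

lemma eta_eval_zero_psi (p : R S) : eta ((psi p).eval 0) = (psi p).eval 0 := by
  have : (eta.comp (evalRingHom (0 : R S))).comp psi = (evalRingHom (0 : R S)).comp psi := by
    apply MvPolynomial.ringHom_ext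
    · intro r; simp [psi, eta]
    · intro v; cases v <;> simp [psi, eta]
  exact congrArg (fun f : R S →+* R S => f p) this

lemma unit_of_phi {a b : R S} (hp : Good (a * b)) (h : IsUnit (phi a)) : IsUnit a := by
  have hlc := hp.lc
  rw [map_mul, leadingCoeff_mul, map_mul] at hlc
  have hu : IsUnit (eta (psi a).leadingCoeff) := IsUnit.of_mul_eq_one _ hlc
  have hd : (psi a).natDegree = 0 := by
    have h1 : (phi a).natDegree = (psi a).natDegree := by
      apply natDegree_map_of_leadingCoeff_ne_zero
      exact (hu.map rho).ne_zero
    rw [← h1]; exact natDegree_eq_zero_of_isUnit h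
  obtain ⟨c, hc⟩ := natDegree_eq_zero.1 hd
  have e1 := eval_one_psi a
  have e2 := eta_eval_zero_psi a
  rw [← hc, eval_C] at e1 e2
  rw [← hc, leadingCoeff_C, e2, e1] at hu
  exact hu

lemma irr_of_phi {p : R S} (hp : Good p) (h : Irreducible (phi p)) : Irreducible p := by
  refine ⟨fun hu => h.not_isUnit (hu.map phi), ?_⟩
  rintro a b rfl
  rcases h.isUnit_or_isUnit (map_mul phi a b) with h | h
  · exact Or.inl (unit_of_phi hp h)
  · rw [mul_comm] at hp
    exact Or.inr (unit_of_phi hp h)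

mutual
theorem good_P : ∀ (b : Bool) (T : RTree (Var S)), SpecialAux b T → Good T.P
  | _, .node k [], h => by
      simp only [SpecialAux] at h
      obtain ⟨i, rfl⟩ := h
      rw [RTree.P]; exact good_x i
  | b, .node k [t], h => by
      simp only [SpecialAux] at h
      have := good_P true t h.2
      rw [RTree.P, RTree.Pprod, RTree.Pprod, mul_one]
      refine good_add this ?_
      rcases h.1 with rfl | ⟨_, rfl⟩ <;> trivial
  | _, .node k (t₁ :: t₂ :: ts), h => by
      simp only [SpecialAux] at h
      rw [RTree.P]
      refine good_add (good_Pprod _ _ h.2) ?_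
      rcases h.1 with rfl | rfl | ⟨_, rfl⟩ <;> trivial
termination_by _ T => sizeOf T
theorem good_Pprod : ∀ (t : RTree (Var S)) (ts : List (RTree (Var S))),
    SpecialList (t :: ts) → Good (RTree.Pprod (t :: ts))
  | t, [], h => by
      simp only [SpecialList] at h
      rw [RTree.Pprod, RTree.Pprod, mul_one]
      exact good_P false t h.1
  | t, t' :: ts, h => by
      rw [SpecialList] at h
      rw [RTree.Pprod]
      exact good_mul (good_P false t h.1) (good_Pprod t' ts h.2)
termination_by t ts => sizeOf (t :: ts)
end

lemma irr_add {p : R S} (hp : Good p) {k : Var S} (hk : Internal k) :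
    Irreducible (MvPolynomial.X k + p) := by
  have hg := good_add hp hk
  refine irr_of_phi hg (phi_irr hg ?_)
  rw [map_add, phi_int hk]; simp; linarith [hp.c1]

theorem irr_P : ∀ (b : Bool) (T : RTree (Var S)), SpecialAux b T → Irreducible T.P
  | _, .node k [], h => by
      rw [RTree.P]; exact (MvPolynomial.X_prime).irreducible
  | b, .node k [t], h => by
      simp only [SpecialAux] at h
      rw [RTree.P, RTree.Pprod, RTree.Pprod, mul_one]
      refine irr_add (good_P true t h.2) ?_
      rcases h.1 with rfl | ⟨_, rfl⟩ <;> trivial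
  | _, .node k (t₁ :: t₂ :: ts), h => by
      simp only [SpecialAux] at h
      rw [RTree.P]
      refine irr_add (good_Pprod _ _ h.2) ?_
      rcases h.1 with rfl | rfl | ⟨_, rfl⟩ <;> trivial

end SpecialIrr

/-- For every special pair `(T,λ)`, the polynomial `P(T,λ)` is
irreducible (in the polynomial ring over the occurring variables, equivalently,
in the whole multivariate polynomial ring `ℤ[{xᵢ},y,z,S]`). -/
theorem P_irreducible {S : Type} (T : RTree (Var S)) (hT : IsSpecial T) :
    Irreducible T.P := by
  exact SpecialIrr.irr_P false T hT
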